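/- Let n ≥ 1 and let T be a computable consistent extension of PA. (1) If φ is a Σ_n sentence which is Σ_n↓Π_n-conservative over T, then φ is Π_n-conservative over T. (2) If φ is a Π_n sentence which is Σ_n↓Π_n-conservative over T, then φ is Σ_n-conservative over T. Moreover, if φ is a Π_n sentence which is Δ_n-conservative over T, then φ is Σ_n-conservative over T. -/

import Mathlib

open FirstOrder Language
open scoped FirstOrder

namespace Guaspari

/-- The first-order language of arithmetic: a constant `0`, a unary function `S`,
binary functions `+` (coded `false`) and `·` (coded `true`), and a binary relation `≤`. -/
def LA : FirstOrder.Language :=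
  ⟨fun n => match n with | 0 => Unit | 1 => Unit | 2 => Bool | _ => Empty,
   fun n => match n with | 2 => Unit | _ => Empty⟩

/-- Sentences of the language of arithmetic. -/
abbrev Snt : Type := LA.Sentence

/-- Theories (sets of sentences) in the language of arithmetic. -/
abbrev Thy : Type := LA.Theory

/-- The term `0`. -/
def zeroT {α : Type} {n : ℕ} : LA.Term (α ⊕ Fin n) :=
  Constants.term (show LA.Constants from Unit.unit)

/-- The term `S t`. -/
def succT {α : Type} {n : ℕ} (t : LA.Term (α ⊕ Fin n)) : LA.Term (α ⊕ Fin n) :=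
  Functions.apply₁ (show LA.Functions 1 from Unit.unit) t

/-- The term `t + u`. -/
def addT {α : Type} {n : ℕ} (t u : LA.Term (α ⊕ Fin n)) : LA.Term (α ⊕ Fin n) :=
  Functions.apply₂ (show LA.Functions 2 from false) t u

/-- The term `t * u`. -/
def mulT {α : Type} {n : ℕ} (t u : LA.Term (α ⊕ Fin n)) : LA.Term (α ⊕ Fin n) :=
  Functions.apply₂ (show LA.Functions 2 from true) t u

/-- The atomic formula `t ≤ u`. -/
def leF {α : Type} {n : ℕ} (t u : LA.Term (α ⊕ Fin n)) : LA.BoundedFormula α n :=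
  Relations.boundedFormula₂ (show LA.Relations 2 from Unit.unit) t u

/-- The `i`-th (de Bruijn-indexed) bound variable as a term. -/
def vT {m : ℕ} (i : Fin m) : LA.Term (Empty ⊕ Fin m) := Term.var (Sum.inr i)

/-- The induction axiom for the formula `φ(x₀,…,x_{k-1}, x_k)` with induction on `x_k`,
universally closed over the parameters `x₀,…,x_{k-1}`. -/
def indAxiom {k : ℕ} (φ : LA.BoundedFormula Empty (k + 1)) : Snt :=
  let base := ∀' ((vT (Fin.last k) =' zeroT) ⟹ φ)
  let step := ∀' (φ ⟹
    ∀' ((vT (Fin.last (k + 1)) =' succT (vT (Fin.castSucc (Fin.last k)))) ⟹ φ.liftAt 1 k))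
  ((base ⊓ step) ⟹ ∀' φ).alls

/-- The axioms of Peano arithmetic `PA`: the basic axioms for `0`, `S`, `+`, `·`, `≤`,
together with the full induction scheme. -/
def PAAx : Thy :=
  {∀' ∼(succT (vT 0) =' zeroT),
   ∀' ∀' ((succT (vT 0) =' succT (vT 1)) ⟹ (vT 0 =' vT 1)),
   ∀' (addT (vT 0) zeroT =' vT 0),
   ∀' ∀' (addT (vT 0) (succT (vT 1)) =' succT (addT (vT 0) (vT 1))),
   ∀' (mulT (vT 0) zeroT =' zeroT),
   ∀' ∀' (mulT (vT 0) (succT (vT 1)) =' addT (mulT (vT 0) (vT 1)) (vT 0)),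
   ∀' ∀' (leF (vT 0) (vT 1) ⇔ ∃' (addT (vT 2) (vT 0) =' vT 1))} ∪
  {φ | ∃ (k : ℕ) (ψ : LA.BoundedFormula Empty (k + 1)), φ = indAxiom ψ}

/-- `Prv T φ`: the sentence `φ` is provable from the theory `T` (equivalently, by the
Gödel completeness theorem, `φ` holds in every model of `T`). -/
def Prv (T : Thy) (φ : Snt) : Prop := T ⊨ᵇ φ

/-- `Th T`: the set of sentences provable from `T`. -/
def Th (T : Thy) : Set Snt := {φ | Prv T φ}

/-- `Con T`: the theory `T` is consistent. -/
def Con (T : Thy) : Prop := ¬ Prv T ⊥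

/-- The theory `T + φ`. -/
def add (T : Thy) (φ : Snt) : Thy := insert φ T

/-- `T` is an extension of `PA`. -/
def ExtPA (T : Thy) : Prop := ∀ φ ∈ PAAx, Prv T φ

/-- `V` is a subtheory of `T` (containing `PA`, as assumed throughout the paper). -/
def SubThy (V T : Thy) : Prop := ExtPA V ∧ ∀ φ, Prv V φ → Prv T φ

/-- Δ₀ (bounded) formulas. -/
inductive IsDelta0 : ∀ {m : ℕ}, LA.BoundedFormula Empty m → Prop
  | falsum {m : ℕ} : IsDelta0 (⊥ : LA.BoundedFormula Empty m)
  | equal {m : ℕ} (t u : LA.Term (Empty ⊕ Fin m)) : IsDelta0 (t =' u)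
  | le {m : ℕ} (t u : LA.Term (Empty ⊕ Fin m)) : IsDelta0 (leF t u)
  | imp {m : ℕ} {φ ψ : LA.BoundedFormula Empty m} :
      IsDelta0 φ → IsDelta0 ψ → IsDelta0 (φ ⟹ ψ)
  | ball {m : ℕ} (t : LA.Term (Empty ⊕ Fin m)) {φ : LA.BoundedFormula Empty (m + 1)} :
      IsDelta0 φ →
      IsDelta0 (∀' (leF (vT (Fin.last m)) (t.relabel (Sum.map id Fin.castSucc)) ⟹ φ))
  | bex {m : ℕ} (t : LA.Term (Empty ⊕ Fin m)) {φ : LA.BoundedFormula Empty (m + 1)} :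
      IsDelta0 φ →
      IsDelta0 (∃' (leF (vT (Fin.last m)) (t.relabel (Sum.map id Fin.castSucc)) ⊓ φ))

mutual
  /-- `Σ_k` formulas (cumulatively: every `Π_k` formula is `Σ_{k+1}`). -/
  inductive IsSigmaFml : ℕ → ∀ {m : ℕ}, LA.BoundedFormula Empty m → Prop
    | ofDelta0 {m : ℕ} {φ : LA.BoundedFormula Empty m} : IsDelta0 φ → IsSigmaFml 0 φ
    | ofPi {k : ℕ} {m : ℕ} {φ : LA.BoundedFormula Empty m} :
        IsPiFml k φ → IsSigmaFml (k + 1) φ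
    | ex {k : ℕ} {m : ℕ} {φ : LA.BoundedFormula Empty (m + 1)} :
        IsSigmaFml (k + 1) φ → IsSigmaFml (k + 1) (∃' φ)
  /-- `Π_k` formulas (cumulatively: every `Σ_k` formula is `Π_{k+1}`). -/
  inductive IsPiFml : ℕ → ∀ {m : ℕ}, LA.BoundedFormula Empty m → Prop
    | ofDelta0 {m : ℕ} {φ : LA.BoundedFormula Empty m} : IsDelta0 φ → IsPiFml 0 φ
    | ofSigma {k : ℕ} {m : ℕ} {φ : LA.BoundedFormula Empty m} :
        IsSigmaFml k φ → IsPiFml (k + 1) φ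
    | all {k : ℕ} {m : ℕ} {φ : LA.BoundedFormula Empty (m + 1)} :
        IsPiFml (k + 1) φ → IsPiFml (k + 1) (∀' φ)
end

/-- The set of `Σ_k` sentences. -/
def SigmaS (k : ℕ) : Set Snt := {φ | IsSigmaFml k φ}

/-- The set of `Π_k` sentences. -/
def PiS (k : ℕ) : Set Snt := {φ | IsPiFml k φ}

/-- The set of `Σ_k ∧ Π_k` sentences, i.e. sentences of the form `σ ∧ π` with
`σ` a `Σ_k` sentence and `π` a `Π_k` sentence. -/
def SigAndPiS (k : ℕ) : Set Snt :=
  {φ | ∃ σ ∈ SigmaS k, ∃ π ∈ PiS k, φ = σ ⊓ π}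

/-- `B(Σ_k)` sentences: Boolean combinations of `Σ_k` sentences. -/
inductive IsBoolSigma (k : ℕ) : Snt → Prop
  | base {φ : Snt} : φ ∈ SigmaS k → IsBoolSigma k φ
  | not {φ : Snt} : IsBoolSigma k φ → IsBoolSigma k (∼φ)
  | imp {φ ψ : Snt} : IsBoolSigma k φ → IsBoolSigma k ψ → IsBoolSigma k (φ ⟹ ψ)
  | inf {φ ψ : Snt} : IsBoolSigma k φ → IsBoolSigma k ψ → IsBoolSigma k (φ ⊓ ψ)
  | sup {φ ψ : Snt} : IsBoolSigma k φ → IsBoolSigma k ψ → IsBoolSigma k (φ ⊔ ψ)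

/-- The set of `B(Σ_k)` sentences. -/
def BSigmaS (k : ℕ) : Set Snt := {φ | IsBoolSigma k φ}

/-- The set of `Γ` sentences provable in `T`, `Th_Γ(T)`. -/
def ThIn (Γ : Set Snt) (T : Thy) : Set Snt := Γ ∩ Th T

instance (i : ℕ) : Encodable (LA.Functions i) :=
  match i with
  | 0 => inferInstanceAs (Encodable Unit)
  | 1 => inferInstanceAs (Encodable Unit)
  | 2 => inferInstanceAs (Encodable Bool)
  | (_ + 3) => inferInstanceAs (Encodable Empty)

instance (i : ℕ) : Encodable (LA.Relations i) :=
  match i with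
  | 0 => inferInstanceAs (Encodable Empty)
  | 1 => inferInstanceAs (Encodable Empty)
  | 2 => inferInstanceAs (Encodable Unit)
  | (_ + 3) => inferInstanceAs (Encodable Empty)

/-- A Gödel numbering of sentences, via Mathlib's encoding of bounded formulas. -/
def gnum (φ : Snt) : ℕ :=
  Encodable.encode
    (show List ((Σ k, LA.Term (Empty ⊕ Fin k)) ⊕ ((Σ n, LA.Relations n) ⊕ ℕ)) from
      BoundedFormula.encoding.encode (⟨0, φ⟩ : Σ n, LA.BoundedFormula Empty n))

/-- The (axiom set of the) theory `T` is computable. -/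
def CompThy (T : Thy) : Prop :=
  ComputablePred (fun m : ℕ => ∃ φ ∈ T, gnum φ = m)

/-- `T` is a computable consistent extension of `PA`. -/
def GoodThy (T : Thy) : Prop := CompThy T ∧ Con T ∧ ExtPA T

/-- `φ` is `Γ`-conservative over `T` for a class of sentences `Γ`:
every `Γ` sentence provable in `T + φ` is provable in `T`. -/
def ConsIn (Γ : Set Snt) (T : Thy) (φ : Snt) : Prop :=
  ∀ γ ∈ Γ, Prv (add T φ) γ → Prv T γ

/-- `φ` is hereditarily `Γ`-conservative over `T`: `Γ`-conservative over every
subtheory of `T` (containing `PA`). -/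
def HConsIn (Γ : Set Snt) (T : Thy) (φ : Snt) : Prop :=
  ∀ V : Thy, SubThy V T → ConsIn Γ V φ

/-- `φ` is `Σ_k↓Π_k`-conservative over `V`. -/
def SPCons (k : ℕ) (V : Thy) (φ : Snt) : Prop :=
  ∀ σ ∈ SigmaS k, ∀ π ∈ PiS k, Prv (add V φ) (σ ⊓ π) → Prv V (σ ⊔ π)

/-- `φ` is hereditarily `Σ_k↓Π_k`-conservative over `T`. -/
def HSPCons (k : ℕ) (T : Thy) (φ : Snt) : Prop :=
  ∀ V : Thy, SubThy V T → SPCons k V φ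

/-- The theory `S` is `Σ_k↓Π_k`-conservative over `PA`. -/
def ThySPConsPA (k : ℕ) (S : Thy) : Prop :=
  ∀ σ ∈ SigmaS k, ∀ π ∈ PiS k, Prv S (σ ⊓ π) → Prv PAAx (σ ⊔ π)

/-- `δ` is a `Δ_k(S)` sentence: `S`-provably equivalent to both a `Σ_k` sentence
and a `Π_k` sentence. -/
def IsDeltaIn (k : ℕ) (S : Thy) (δ : Snt) : Prop :=
  (∃ σ ∈ SigmaS k, Prv S (δ ⇔ σ)) ∧ ∃ π ∈ PiS k, Prv S (δ ⇔ π)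

/-- `φ` is `Δ_k(S)`-conservative over `V`. -/
def DeltaConsRel (k : ℕ) (S V : Thy) (φ : Snt) : Prop :=
  ∀ δ : Snt, IsDeltaIn k S δ → Prv (add V φ) δ → Prv V δ

/-- `φ` is `Δ_k`-conservative over `T`, i.e. `Δ_k(Th(T))`-conservative over `T`. -/
def DeltaCons (k : ℕ) (T : Thy) (φ : Snt) : Prop := DeltaConsRel k (Th T) T φ

/-- `φ` is hereditarily `Δ_k`-conservative over `T`. -/
def HDeltaCons (k : ℕ) (T : Thy) (φ : Snt) : Prop :=
  ∀ V : Thy, SubThy V T → DeltaConsRel k (Th V) V φ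

/-- `φ` is doubly `Π_k`-conservative over `T`: `φ` is `Π_k`-conservative and `¬φ` is
`Σ_k`-conservative over `T`. -/
def DCons (k : ℕ) (T : Thy) (φ : Snt) : Prop :=
  ConsIn (PiS k) T φ ∧ ConsIn (SigmaS k) T (∼φ)

/-- `φ` is hereditarily doubly `Π_k`-conservative over `T`. -/
def HDCons (k : ℕ) (T : Thy) (φ : Snt) : Prop :=
  ∀ V : Thy, SubThy V T → DCons k V φ

/-- `(T,U)` is a `B_n`-pair. -/
def Bpair (n : ℕ) (T U : Thy) : Prop :=
  (¬ ThIn (PiS n) T ⊆ Th U ∨ Con (T ∪ ThIn (PiS n) U)) ∧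
  (¬ ThIn (PiS n) U ⊆ Th T ∨ Con (U ∪ ThIn (PiS n) T))

/-- `(T,U)` is a `C_n`-pair. -/
def Cpair (n : ℕ) (T U : Thy) : Prop :=
  Con (T ∪ ThIn (PiS n) U) ∧ Con (U ∪ ThIn (PiS n) T)

/-- `(T,U)` is a `C⁻_n`-pair. -/
def Cmpair (n : ℕ) (T U : Thy) : Prop :=
  Con (T ∪ ThIn (PiS n) U) ∨ Con (U ∪ ThIn (PiS n) T)

/-- `(T,U)` is a `C^∧_n`-pair. -/
def Capair (n : ℕ) (T U : Thy) : Prop :=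
  Con (T ∪ ThIn (SigAndPiS n) U) ∧ Con (U ∪ ThIn (SigAndPiS n) T)

/-- `(T,U)` is a `C^B_n`-pair. -/
def CBpair (n : ℕ) (T U : Thy) : Prop :=
  Con (T ∪ ThIn (BSigmaS n) U)



/-! ### Models of PA -/

/-- Models of PA. -/
abbrev PM : Type 1 := PAAx.ModelType

/-- Extend an assignment by one value. -/
def sn {A : Type} {m : ℕ} (v : Fin m → A) (x : A) : Fin (m + 1) → A :=
  Fin.snoc (α := fun _ => A) v x

theorem sn_last {A : Type} {m : ℕ} (v : Fin m → A) (x : A) : sn v x (Fin.last m) = x := by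
  simp [sn]

theorem sn_castSucc {A : Type} {m : ℕ} (v : Fin m → A) (x : A) (i : Fin m) :
    sn v x i.castSucc = v i := by
  simp [sn]

theorem comp_sn {A B : Type} {m : ℕ} (w : A → B) (v : Fin m → A) (x : A) :
    w ∘ sn v x = sn (w ∘ v) (w x) := by
  funext i
  refine Fin.lastCases ?_ (fun j => ?_) i
  · simp [sn_last]
  · simp [sn_castSucc]

def zz (M : PM) : M := Structure.funMap (L := LA) (show LA.Functions 0 from Unit.unit) ![]
def ss {M : PM} (x : M) : M := Structure.funMap (L := LA) (show LA.Functions 1 from Unit.unit) ![x]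
def pp {M : PM} (x y : M) : M := Structure.funMap (L := LA) (show LA.Functions 2 from false) ![x, y]
def mle {M : PM} (x y : M) : Prop :=
  Structure.RelMap (L := LA) (show LA.Relations 2 from Unit.unit) ![x, y]

section terms
variable {M : PM} {n : ℕ} (v : Empty → M) (xs : Fin n → M)

theorem r_v (i : Fin n) : (vT i).realize (Sum.elim v xs) = xs i := rfl

theorem r_zero : (zeroT : LA.Term (Empty ⊕ Fin n)).realize (Sum.elim v xs) = zz M := by
  unfold zeroT zz Constants.term
  show Structure.funMap _ _ = Structure.funMap _ _
  congr 1
  exact Subsingleton.elim _ _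

theorem r_succ (t : LA.Term (Empty ⊕ Fin n)) :
    (succT t).realize (Sum.elim v xs) = ss (t.realize (Sum.elim v xs)) := by
  unfold succT ss
  rw [Term.realize_functions_apply₁]

theorem r_add (t u : LA.Term (Empty ⊕ Fin n)) :
    (addT t u).realize (Sum.elim v xs) =
      pp (t.realize (Sum.elim v xs)) (u.realize (Sum.elim v xs)) := by
  unfold addT pp
  rw [Term.realize_functions_apply₂]

theorem r_le (t u : LA.Term (Empty ⊕ Fin n)) :
    (leF t u).Realize v xs ↔ mle (t.realize (Sum.elim v xs)) (u.realize (Sum.elim v xs)) := by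
  unfold leF mle
  rw [BoundedFormula.realize_rel₂]

theorem r_all (φ : LA.BoundedFormula Empty (n + 1)) :
    (∀' φ).Realize v xs ↔ ∀ a : M, φ.Realize v (sn xs a) := BoundedFormula.realize_all

theorem r_ex (φ : LA.BoundedFormula Empty (n + 1)) :
    (∃' φ).Realize v xs ↔ ∃ a : M, φ.Realize v (sn xs a) := BoundedFormula.realize_ex

theorem r_eq (t u : LA.Term (Empty ⊕ Fin n)) :
    (t =' u).Realize v xs ↔ t.realize (Sum.elim v xs) = u.realize (Sum.elim v xs) :=
  BoundedFormula.realize_bdEqual t u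

end terms

theorem pa_ax (M : PM) {φ : Snt} (h : φ ∈ PAAx) : φ.Realize M :=
  Theory.realize_sentence_of_mem PAAx h

theorem sn1_0 {A : Type} (v : Fin 0 → A) (x : A) : sn v x 0 = x := sn_last v x
theorem sn2_0 {A : Type} (v : Fin 0 → A) (x y : A) : sn (sn v x) y 0 = x :=
  (sn_castSucc (sn v x) y 0).trans (sn1_0 v x)
theorem sn2_1 {A : Type} (v : Fin 0 → A) (x y : A) : sn (sn v x) y 1 = y := sn_last _ _
theorem sn3_0 {A : Type} (v : Fin 0 → A) (x y z : A) : sn (sn (sn v x) y) z 0 = x :=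
  (sn_castSucc (sn (sn v x) y) z 0).trans (sn2_0 v x y)
theorem sn3_1 {A : Type} (v : Fin 0 → A) (x y z : A) : sn (sn (sn v x) y) z 1 = y :=
  (sn_castSucc (sn (sn v x) y) z 1).trans (sn2_1 v x y)
theorem sn3_2 {A : Type} (v : Fin 0 → A) (x y z : A) : sn (sn (sn v x) y) z 2 = z :=
  sn_last _ _

theorem ss_ne (M : PM) (x : M) : ss x ≠ zz M := by
  have h := pa_ax M (φ := ∀' ∼(succT (vT 0) =' zeroT)) (by simp [PAAx])
  have h2 := (r_all _ _ _).1 h x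
  rw [BoundedFormula.realize_not, r_eq, r_succ, r_zero, r_v, sn1_0] at h2
  exact h2

theorem ss_inj (M : PM) (x y : M) : ss x = ss y → x = y := by
  have h := pa_ax M (φ := ∀' ∀' ((succT (vT 0) =' succT (vT 1)) ⟹ (vT 0 =' vT 1)))
    (by simp [PAAx])
  have h2 := (r_all _ _ _).1 ((r_all _ _ _).1 h x) y
  rw [BoundedFormula.realize_imp, r_eq, r_eq, r_succ, r_succ, r_v, r_v, sn2_0, sn2_1] at h2
  exact h2

theorem pp_zero (M : PM) (x : M) : pp x (zz M) = x := by
  have h := pa_ax M (φ := ∀' (addT (vT 0) zeroT =' vT 0)) (by simp [PAAx])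
  have h2 := (r_all _ _ _).1 h x
  rw [r_eq, r_add, r_zero, r_v, sn1_0] at h2
  exact h2

theorem pp_succ (M : PM) (x y : M) : pp x (ss y) = ss (pp x y) := by
  have h := pa_ax M (φ := ∀' ∀' (addT (vT 0) (succT (vT 1)) =' succT (addT (vT 0) (vT 1))))
    (by simp [PAAx])
  have h2 := (r_all _ _ _).1 ((r_all _ _ _).1 h x) y
  rw [r_eq, r_add, r_succ, r_succ, r_add, r_v, r_v, sn2_0, sn2_1] at h2
  exact h2

theorem mle_iff (M : PM) (x y : M) : mle x y ↔ ∃ z, pp z x = y := by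
  have h := pa_ax M (φ := ∀' ∀' (leF (vT 0) (vT 1) ⇔ ∃' (addT (vT 2) (vT 0) =' vT 1)))
    (by simp [PAAx])
  have h2 := (r_all _ _ _).1 ((r_all _ _ _).1 h x) y
  rw [BoundedFormula.realize_iff, r_le, r_ex, r_v, r_v, sn2_0, sn2_1] at h2
  rw [h2]
  refine exists_congr fun z => ?_
  rw [r_eq, r_add, r_v, r_v, r_v, sn3_0, sn3_1, sn3_2]

/-- Semantic form of the induction scheme. -/
theorem ind_fml {M : PM} {k : ℕ} (ψ : LA.BoundedFormula Empty (k + 1)) (v : Fin k → M)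
    (h0 : ψ.Realize default (sn v (zz M)))
    (hs : ∀ a : M, ψ.Realize default (sn v a) → ψ.Realize default (sn v (ss a))) (a : M) :
    ψ.Realize default (sn v a) := by
  have h := pa_ax M (φ := indAxiom ψ) (Or.inr ⟨k, ψ, rfl⟩)
  have h2 := (BoundedFormula.realize_alls (v := (default : Empty → M))).1 h v
  rw [BoundedFormula.realize_imp] at h2
  refine (r_all _ _ _).1 (h2 ?_) a
  rw [BoundedFormula.realize_inf]
  constructor
  · rw [r_all]
    intro b
    rw [BoundedFormula.realize_imp, r_eq, r_zero, r_v, sn_last]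
    rintro rfl
    exact h0
  · rw [r_all]
    intro b
    rw [BoundedFormula.realize_imp, r_all]
    intro hb c
    rw [BoundedFormula.realize_imp, r_eq, r_succ, r_v, r_v, sn_last, sn_castSucc, sn_last]
    rintro rfl
    rw [BoundedFormula.realize_liftAt_one (by omega)]
    convert hs b hb using 1
    funext i
    refine Fin.lastCases ?_ (fun j => ?_) i
    · simp [sn_last]
    · simp [sn_castSucc]

/-! ### Representable predicates -/

/-- Predicates (uniformly) on models of PA. -/
abbrev Pr (m : ℕ) : Type 1 := ∀ M : PM, (Fin m → M) → Prop

def Rep (C : ∀ {m : ℕ}, LA.BoundedFormula Empty m → Prop) {m : ℕ} (P : Pr m) : Prop :=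
  ∃ ψ : LA.BoundedFormula Empty m, C ψ ∧ ∀ (M : PM) (v : Fin m → M),
    P M v ↔ ψ.Realize default v

abbrev D0 {m : ℕ} (P : Pr m) : Prop := Rep IsDelta0 P
abbrev Sg (k : ℕ) {m : ℕ} (P : Pr m) : Prop := Rep (IsSigmaFml k) P
abbrev Pg (k : ℕ) {m : ℕ} (P : Pr m) : Prop := Rep (IsPiFml k) P
abbrev Df {m : ℕ} (P : Pr m) : Prop := Rep (fun {_} _ => True) P

theorem Rep.congr {C : ∀ {m : ℕ}, LA.BoundedFormula Empty m → Prop} {m : ℕ} {P Q : Pr m}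
    (h : Rep C P) (e : ∀ (M : PM) (v : Fin m → M), Q M v ↔ P M v) : Rep C Q := by
  obtain ⟨ψ, hψ, h⟩ := h
  exact ⟨ψ, hψ, fun M v => (e M v).trans (h M v)⟩

theorem Rep.df {C : ∀ {m : ℕ}, LA.BoundedFormula Empty m → Prop} {m : ℕ} {P : Pr m}
    (h : Rep C P) : Df P := by
  obtain ⟨ψ, hψ, h⟩ := h
  exact ⟨ψ, trivial, h⟩

theorem Df.ind {k : ℕ} {P : Pr (k + 1)} (hP : Df P) (M : PM) (v : Fin k → M)
    (h0 : P M (sn v (zz M))) (hs : ∀ a : M, P M (sn v a) → P M (sn v (ss a))) (a : M) :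
    P M (sn v a) := by
  obtain ⟨ψ, -, h⟩ := hP
  rw [h]
  refine ind_fml ψ v ((h _ _).1 h0) (fun a ha => ?_) a
  exact (h _ _).1 (hs a ((h _ _).2 ha))

theorem Df.imp {k : ℕ} {P Q : Pr k} (hP : Df P) (hQ : Df Q) : Df (fun M v => P M v → Q M v) := by
  obtain ⟨ψ, -, h⟩ := hP
  obtain ⟨χ, -, h'⟩ := hQ
  exact ⟨ψ ⟹ χ, trivial, fun M v => by simp only [BoundedFormula.realize_imp, h, h']⟩

theorem Df.all {k : ℕ} {P : Pr (k + 1)} (hP : Df P) :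
    Df (fun M v => ∀ x : M, P M (sn v x)) := by
  obtain ⟨ψ, -, h⟩ := hP
  exact ⟨∀' ψ, trivial, fun M v => by rw [r_all]; exact forall_congr' fun x => h _ _⟩

theorem Df.ex {k : ℕ} {P : Pr (k + 1)} (hP : Df P) :
    Df (fun M v => ∃ x : M, P M (sn v x)) := by
  obtain ⟨ψ, -, h⟩ := hP
  exact ⟨∃' ψ, trivial, fun M v => by rw [r_ex]; exact exists_congr fun x => h _ _⟩

theorem D0.le {m : ℕ} (i j : Fin m) : D0 (fun M v => mle (v i) (v j) : Pr m) :=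
  ⟨leF (vT i) (vT j), .le _ _, fun M v => by rw [r_le, r_v, r_v]⟩

theorem D0.eq {m : ℕ} (i j : Fin m) : D0 (fun M v => v i = v j : Pr m) :=
  ⟨vT i =' vT j, .equal _ _, fun M v => by rw [r_eq, r_v, r_v]⟩

/-! ### Order facts -/

section order
variable (M : PM)

theorem zero_pp (x : M) : pp (zz M) x = x := by
  have hP : Df (m := 1) (fun M v => pp (zz M) (v 0) = v 0) :=
    ⟨addT zeroT (vT 0) =' vT 0, trivial, fun M v => by rw [r_eq, r_add, r_zero, r_v]⟩
  have := hP.ind M default (by simp only [sn1_0]; exact pp_zero M _)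
    (by intro a; simp only [sn1_0]; intro h; rw [pp_succ, h]) x
  simpa only [sn1_0] using this

theorem succ_pp (x y : M) : pp (ss x) y = ss (pp x y) := by
  have hP : Df (m := 2) (fun M v => pp (ss (v 0)) (v 1) = ss (pp (v 0) (v 1))) :=
    ⟨addT (succT (vT 0)) (vT 1) =' succT (addT (vT 0) (vT 1)), trivial,
      fun M v => by rw [r_eq, r_add, r_succ, r_succ, r_add, r_v, r_v]⟩
  have := hP.ind M (sn default x) (by simp only [sn2_0, sn2_1]; rw [pp_zero, pp_zero])
    (by intro a; simp only [sn2_0, sn2_1]; intro h; rw [pp_succ, h, pp_succ]) y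
  simpa only [sn2_0, sn2_1] using this

theorem pp_assoc (x y z : M) : pp x (pp y z) = pp (pp x y) z := by
  have hP : Df (m := 3) (fun M v => pp (v 0) (pp (v 1) (v 2)) = pp (pp (v 0) (v 1)) (v 2)) :=
    ⟨addT (vT 0) (addT (vT 1) (vT 2)) =' addT (addT (vT 0) (vT 1)) (vT 2), trivial,
      fun M v => by rw [r_eq, r_add, r_add, r_add, r_add, r_v, r_v, r_v]⟩
  have := hP.ind M (sn (sn default x) y)
    (by simp only [sn3_0, sn3_1, sn3_2]; rw [pp_zero, pp_zero])
    (by intro a; simp only [sn3_0, sn3_1, sn3_2]; intro h; rw [pp_succ, pp_succ, pp_succ, h]) z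
  simpa only [sn3_0, sn3_1, sn3_2] using this

theorem zero_or_succ (x : M) : x = zz M ∨ ∃ y, x = ss y := by
  have hP : Df (m := 1) (fun M v => v 0 = zz M ∨ ∃ y, v 0 = ss y) :=
    ⟨(vT 0 =' zeroT) ⊔ ∃' (vT 0 =' succT (vT 1)), trivial, fun M v => by
      rw [BoundedFormula.realize_sup, r_eq, r_zero, r_v, r_ex]
      refine or_congr Iff.rfl (exists_congr fun y => ?_)
      rw [r_eq, r_succ, r_v, r_v]
      have e0 : sn v y 0 = v 0 := sn_castSucc v y 0
      have e1 : sn v y 1 = y := sn_last v y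
      rw [e0, e1]⟩
  have := hP.ind M default (by simp only [sn1_0]; exact Or.inl trivial)
    (by intro a; simp only [sn1_0]; intro _; exact Or.inr ⟨a, rfl⟩) x
  simpa only [sn1_0] using this

theorem mle_refl (x : M) : mle x x := (mle_iff M _ _).2 ⟨_, zero_pp M x⟩

theorem mle_trans {x y z : M} (h : mle x y) (h' : mle y z) : mle x z := by
  obtain ⟨a, ha⟩ := (mle_iff M _ _).1 h
  obtain ⟨b, hb⟩ := (mle_iff M _ _).1 h'
  exact (mle_iff M _ _).2 ⟨pp b a, by rw [← pp_assoc, ha, hb]⟩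

theorem mle_succ {x y : M} (h : mle x y) : mle x (ss y) := by
  obtain ⟨a, ha⟩ := (mle_iff M _ _).1 h
  exact (mle_iff M _ _).2 ⟨ss a, by rw [succ_pp, ha]⟩

theorem mle_zero {x : M} (h : mle x (zz M)) : x = zz M := by
  obtain ⟨a, ha⟩ := (mle_iff M _ _).1 h
  rcases zero_or_succ M x with hx | ⟨y, rfl⟩
  · exact hx
  · rw [pp_succ] at ha
    exact (ss_ne M _ ha).elim

theorem mle_succ_cases {x y : M} (h : mle x (ss y)) : mle x y ∨ x = ss y := by
  obtain ⟨a, ha⟩ := (mle_iff M _ _).1 h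
  rcases zero_or_succ M a with rfl | ⟨b, rfl⟩
  · rw [zero_pp] at ha
    exact Or.inr ha
  · rw [succ_pp] at ha
    exact Or.inl ((mle_iff M _ _).2 ⟨b, ss_inj M _ _ ha⟩)

theorem mle_total (x y : M) : mle x y ∨ mle y x := by
  have hP : Df (m := 2) (fun M v => mle (v 1) (v 0) ∨ mle (v 0) (v 1)) :=
    ⟨leF (vT 1) (vT 0) ⊔ leF (vT 0) (vT 1), trivial, fun M v => by
      rw [BoundedFormula.realize_sup, r_le, r_le, r_v, r_v]⟩
  have := hP.ind M (sn default y)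
    (by simp only [sn2_0, sn2_1]; exact Or.inl ((mle_iff M _ _).2 ⟨y, pp_zero M y⟩))
    (by
      intro a
      simp only [sn2_0, sn2_1]
      rintro (h | h)
      · obtain ⟨b, hb⟩ := (mle_iff M _ _).1 h
        rcases zero_or_succ M b with rfl | ⟨c, rfl⟩
        · rw [zero_pp] at hb
          subst hb
          exact Or.inr (mle_succ M (mle_refl M _))
        · rw [succ_pp, ← pp_succ] at hb
          exact Or.inl ((mle_iff M _ _).2 ⟨c, hb⟩)
      · exact Or.inr (mle_succ M h)) x
  simpa only [sn2_0, sn2_1] using this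

theorem exists_ub (x y : M) : ∃ z, mle x z ∧ mle y z := by
  rcases mle_total M x y with h | h
  · exact ⟨y, h, mle_refl M y⟩
  · exact ⟨x, mle_refl M x, h⟩

end order

/-! ### Renaming of variables -/

def lft {m m' : ℕ} (f : Fin m → Fin m') : Fin (m + 1) → Fin (m' + 1) :=
  sn (Fin.castSucc ∘ f) (Fin.last m')

theorem sn_comp_lft {A : Type} {m m' : ℕ} (f : Fin m → Fin m') (v : Fin m' → A) (x : A) :
    sn v x ∘ lft f = sn (v ∘ f) x := by
  unfold lft
  rw [comp_sn, sn_last, ← Function.comp_assoc]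
  congr 2
  funext i
  simp [sn_castSucc]

def renT {m m' : ℕ} (f : Fin m → Fin m') (t : LA.Term (Empty ⊕ Fin m)) :
    LA.Term (Empty ⊕ Fin m') := t.relabel (Sum.map id f)

def ren : ∀ {m m' : ℕ}, (Fin m → Fin m') → LA.BoundedFormula Empty m → LA.BoundedFormula Empty m'
  | _, _, _, .falsum => .falsum
  | _, _, f, .equal t u => .equal (renT f t) (renT f u)
  | _, _, f, .rel R ts => .rel R (fun i => renT f (ts i))
  | _, _, f, .imp φ ψ => .imp (ren f φ) (ren f ψ)
  | _, _, f, .all φ => .all (ren (lft f) φ)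

theorem renT_realize {M : PM} {m m' : ℕ} (f : Fin m → Fin m') (t : LA.Term (Empty ⊕ Fin m))
    (e : Empty → M) (v : Fin m' → M) :
    (renT f t).realize (Sum.elim e v) = t.realize (Sum.elim e (v ∘ f)) := by
  unfold renT
  rw [Term.realize_relabel]
  congr 1
  funext i
  cases i <;> rfl

theorem ren_realize {M : PM} {m : ℕ} (φ : LA.BoundedFormula Empty m) : ∀ {m' : ℕ}
    (f : Fin m → Fin m') (e : Empty → M) (v : Fin m' → M),
    (ren f φ).Realize e v ↔ φ.Realize e (v ∘ f) := by
  induction φ with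
  | falsum => intros; rfl
  | equal t u =>
    intro m' f e v
    simp only [ren, BoundedFormula.Realize, renT_realize]
  | rel R ts =>
    intro m' f e v
    simp only [ren, BoundedFormula.Realize, renT_realize]
  | imp φ ψ h1 h2 =>
    intro m' f e v
    simp only [ren, BoundedFormula.Realize, h1, h2]
  | all φ h =>
    intro m' f e v
    show (∀ x, (ren (lft f) φ).Realize e (sn v x)) ↔ ∀ x, φ.Realize e (sn (v ∘ f) x)
    refine forall_congr' fun x => ?_
    rw [h, sn_comp_lft]

theorem ren_le {m m' : ℕ} (f : Fin m → Fin m') (t u : LA.Term (Empty ⊕ Fin m)) :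
    ren f (leF t u) = leF (renT f t) (renT f u) := by
  unfold leF Relations.boundedFormula₂ Relations.boundedFormula
  simp only [ren]
  congr 1
  funext i
  fin_cases i <;> rfl

theorem renT_cast {m m' : ℕ} (f : Fin m → Fin m') (t : LA.Term (Empty ⊕ Fin m)) :
    renT (lft f) (t.relabel (Sum.map id Fin.castSucc)) =
      (renT f t).relabel (Sum.map id Fin.castSucc) := by
  unfold renT
  rw [Term.relabel_relabel, Term.relabel_relabel]
  congr 1
  funext i
  rcases i with i | i
  · rfl
  · simp [lft, sn_castSucc]

theorem renT_last {m m' : ℕ} (f : Fin m → Fin m') :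
    renT (lft f) (vT (Fin.last m)) = vT (Fin.last m') := by
  simp [renT, vT, lft, sn_last]

theorem ren_delta {m : ℕ} {φ : LA.BoundedFormula Empty m} (h : IsDelta0 φ) :
    ∀ {m' : ℕ} (f : Fin m → Fin m'), IsDelta0 (ren f φ) := by
  induction h with
  | falsum => intros; exact .falsum
  | equal t u => intros; exact .equal _ _
  | le t u => intro m' f; rw [ren_le]; exact .le _ _
  | imp _ _ h1 h2 => intro m' f; exact .imp (h1 f) (h2 f)
  | ball t _ h =>
    intro m' f
    have := IsDelta0.ball (renT f t) (h (lft f))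
    rw [← renT_last f, ← renT_cast, ← ren_le] at this
    exact this
  | bex t _ h =>
    intro m' f
    have := IsDelta0.bex (renT f t) (h (lft f))
    rw [← renT_last f, ← renT_cast, ← ren_le] at this
    exact this

mutual
theorem ren_sigma : ∀ {k m : ℕ} {φ : LA.BoundedFormula Empty m}, IsSigmaFml k φ →
    ∀ {m' : ℕ} (f : Fin m → Fin m'), IsSigmaFml k (ren f φ)
  | _, _, _, .ofDelta0 h, _, f => .ofDelta0 (ren_delta h f)
  | _, _, _, .ofPi h, _, f => .ofPi (ren_pi h f)
  | _, _, _, .ex h, _, f => .ex (ren_sigma h (lft f))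
theorem ren_pi : ∀ {k m : ℕ} {φ : LA.BoundedFormula Empty m}, IsPiFml k φ →
    ∀ {m' : ℕ} (f : Fin m → Fin m'), IsPiFml k (ren f φ)
  | _, _, _, .ofDelta0 h, _, f => .ofDelta0 (ren_delta h f)
  | _, _, _, .ofSigma h, _, f => .ofSigma (ren_sigma h f)
  | _, _, _, .all h, _, f => .all (ren_pi h (lft f))
end

mutual
theorem mono_sigma : ∀ {k m : ℕ} {φ : LA.BoundedFormula Empty m}, IsSigmaFml k φ →
    IsSigmaFml (k + 1) φ
  | _, _, _, .ofDelta0 h => .ofPi (.ofDelta0 h)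
  | _, _, _, .ofPi h => .ofPi (mono_pi h)
  | _, _, _, .ex h => .ex (mono_sigma h)
theorem mono_pi : ∀ {k m : ℕ} {φ : LA.BoundedFormula Empty m}, IsPiFml k φ →
    IsPiFml (k + 1) φ
  | _, _, _, .ofDelta0 h => .ofSigma (.ofDelta0 h)
  | _, _, _, .ofSigma h => .ofSigma (mono_sigma h)
  | _, _, _, .all h => .all (mono_pi h)
end

theorem Sg.ren {k m m' : ℕ} {P : Pr m} (h : Sg k P) (f : Fin m → Fin m') :
    Sg k (fun M v => P M (v ∘ f)) := by
  obtain ⟨ψ, hψ, h⟩ := h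
  exact ⟨_, ren_sigma hψ f, fun M v => by simp only [ren_realize, h]⟩

theorem Pg.ren {k m m' : ℕ} {P : Pr m} (h : Pg k P) (f : Fin m → Fin m') :
    Pg k (fun M v => P M (v ∘ f)) := by
  obtain ⟨ψ, hψ, h⟩ := h
  exact ⟨_, ren_pi hψ f, fun M v => by simp only [ren_realize, h]⟩

theorem Df.ren {m m' : ℕ} {P : Pr m} (h : Df P) (f : Fin m → Fin m') :
    Df (fun M v => P M (v ∘ f)) := by
  obtain ⟨ψ, hψ, h⟩ := h
  exact ⟨Guaspari.ren f ψ, trivial, fun M v => by simp only [ren_realize, h]⟩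

theorem Sg.ofPg {k m : ℕ} {P : Pr m} (h : Pg k P) : Sg (k + 1) P := by
  obtain ⟨ψ, hψ, h⟩ := h
  exact ⟨_, .ofPi hψ, h⟩

theorem Pg.ofSg {k m : ℕ} {P : Pr m} (h : Sg k P) : Pg (k + 1) P := by
  obtain ⟨ψ, hψ, h⟩ := h
  exact ⟨_, .ofSigma hψ, h⟩

theorem Sg.mono {k m : ℕ} {P : Pr m} (h : Sg k P) : Sg (k + 1) P := by
  obtain ⟨ψ, hψ, h⟩ := h
  exact ⟨_, mono_sigma hψ, h⟩

theorem Pg.mono {k m : ℕ} {P : Pr m} (h : Pg k P) : Pg (k + 1) P := by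
  obtain ⟨ψ, hψ, h⟩ := h
  exact ⟨_, mono_pi hψ, h⟩

theorem Sg.ofD0 {m : ℕ} {P : Pr m} (h : D0 P) : ∀ k, Sg k P
  | 0 => by obtain ⟨ψ, hψ, h⟩ := h; exact ⟨_, .ofDelta0 hψ, h⟩
  | k + 1 => (Sg.ofD0 h k).mono

theorem Pg.ofD0 {m : ℕ} {P : Pr m} (h : D0 P) : ∀ k, Pg k P
  | 0 => by obtain ⟨ψ, hψ, h⟩ := h; exact ⟨_, .ofDelta0 hψ, h⟩
  | k + 1 => (Pg.ofD0 h k).mono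

theorem Sg.toD0 {m : ℕ} {P : Pr m} (h : Sg 0 P) : D0 P := by
  obtain ⟨ψ, hψ, h⟩ := h
  refine ⟨ψ, ?_, h⟩
  cases hψ; assumption

theorem Pg.toD0 {m : ℕ} {P : Pr m} (h : Pg 0 P) : D0 P := by
  obtain ⟨ψ, hψ, h⟩ := h
  refine ⟨ψ, ?_, h⟩
  cases hψ; assumption

theorem Sg.ex {k m : ℕ} {P : Pr (m + 1)} (h : Sg (k + 1) P) :
    Sg (k + 1) (fun M v => ∃ x : M, P M (sn v x)) := by
  obtain ⟨ψ, hψ, h⟩ := h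
  exact ⟨_, .ex hψ, fun M v => by rw [r_ex]; exact exists_congr fun x => h _ _⟩

theorem Pg.all {k m : ℕ} {P : Pr (m + 1)} (h : Pg (k + 1) P) :
    Pg (k + 1) (fun M v => ∀ x : M, P M (sn v x)) := by
  obtain ⟨ψ, hψ, h⟩ := h
  exact ⟨_, .all hψ, fun M v => by rw [r_all]; exact forall_congr' fun x => h _ _⟩

mutual
theorem neg_sigma : ∀ {k m : ℕ} {φ : LA.BoundedFormula Empty m}, IsSigmaFml k φ →
    Pg k (fun (M : PM) (v : Fin m → M) => ¬ φ.Realize default v)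
  | _, _, φ, .ofDelta0 h => ⟨φ ⟹ ⊥, .ofDelta0 (.imp h .falsum), fun _ _ => Iff.rfl⟩
  | _, _, _, .ofPi h => Pg.ofSg (neg_pi h)
  | _, _, _, .ex h => (Pg.all (neg_sigma h)).congr (fun M v => by rw [r_ex, not_exists])
theorem neg_pi : ∀ {k m : ℕ} {φ : LA.BoundedFormula Empty m}, IsPiFml k φ →
    Sg k (fun (M : PM) (v : Fin m → M) => ¬ φ.Realize default v)
  | _, _, φ, .ofDelta0 h => ⟨φ ⟹ ⊥, .ofDelta0 (.imp h .falsum), fun _ _ => Iff.rfl⟩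
  | _, _, _, .ofSigma h => Sg.ofPg (neg_sigma h)
  | _, _, _, .all h => (Sg.ex (neg_pi h)).congr (fun M v => by rw [r_all, not_forall])
end

theorem Sg.neg {k m : ℕ} {P : Pr m} (h : Sg k P) : Pg k (fun M v => ¬ P M v) := by
  obtain ⟨ψ, hψ, h⟩ := h
  exact (neg_sigma hψ).congr (fun M v => by rw [h])

theorem Pg.neg {k m : ℕ} {P : Pr m} (h : Pg k P) : Sg k (fun M v => ¬ P M v) := by
  obtain ⟨ψ, hψ, h⟩ := h
  exact (neg_pi hψ).congr (fun M v => by rw [h])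

theorem Sg.of_neg {k m : ℕ} {P : Pr m} (h : Pg k (fun M v => ¬ P M v)) : Sg k P :=
  h.neg.congr (fun M v => by rw [not_not])

theorem Pg.of_neg {k m : ℕ} {P : Pr m} (h : Sg k (fun M v => ¬ P M v)) : Pg k P :=
  h.neg.congr (fun M v => by rw [not_not])

/-! ### Closure properties -/

theorem D0.imp {m : ℕ} {P Q : Pr m} (hP : D0 P) (hQ : D0 Q) :
    D0 (fun M v => P M v → Q M v) := by
  obtain ⟨ψ, a, h⟩ := hP
  obtain ⟨χ, b, h'⟩ := hQ
  exact ⟨ψ ⟹ χ, .imp a b, fun M v => by simp only [BoundedFormula.realize_imp, h, h']⟩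

theorem D0.neg {m : ℕ} {P : Pr m} (hP : D0 P) : D0 (fun M v => ¬ P M v) := by
  obtain ⟨ψ, a, h⟩ := hP
  exact ⟨ψ ⟹ ⊥, .imp a .falsum, fun M v => by simp only [h]; exact Iff.rfl⟩

theorem D0.and {m : ℕ} {P Q : Pr m} (hP : D0 P) (hQ : D0 Q) :
    D0 (fun M v => P M v ∧ Q M v) :=
  (hP.imp hQ.neg).neg.congr (fun M v => by tauto)

theorem D0.or {m : ℕ} {P Q : Pr m} (hP : D0 P) (hQ : D0 Q) :
    D0 (fun M v => P M v ∨ Q M v) :=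
  (hP.neg.imp hQ).congr (fun M v => by tauto)

theorem D0.ball {m : ℕ} {P : Pr (m + 1)} (hP : D0 P) (i : Fin m) :
    D0 (fun M v => ∀ x : M, mle x (v i) → P M (sn v x)) := by
  obtain ⟨ψ, a, h⟩ := hP
  refine ⟨_, .ball (vT i) a, fun M v => ?_⟩
  rw [r_all]
  refine forall_congr' fun x => ?_
  have e : (vT i).relabel (Sum.map id Fin.castSucc) = (vT i.castSucc : LA.Term _) := rfl
  rw [BoundedFormula.realize_imp, r_le, e, r_v, r_v, sn_last, sn_castSucc, h]

theorem D0.bex {m : ℕ} {P : Pr (m + 1)} (hP : D0 P) (i : Fin m) :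
    D0 (fun M v => ∃ x : M, mle x (v i) ∧ P M (sn v x)) :=
  (hP.neg.ball i).neg.congr (fun M v => by push Not; rfl)

/-- Closure properties at level `k`. -/
structure Clo (k : ℕ) : Prop where
  sand : ∀ {m : ℕ} {P Q : Pr m}, Sg k P → Sg k Q → Sg k (fun M v => P M v ∧ Q M v)
  sor : ∀ {m : ℕ} {P Q : Pr m}, Sg k P → Sg k Q → Sg k (fun M v => P M v ∨ Q M v)
  sbex : ∀ {m : ℕ} {P : Pr (m + 1)}, Sg k P → ∀ i : Fin m,
    Sg k (fun M v => ∃ x : M, mle x (v i) ∧ P M (sn v x))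
  sball : ∀ {m : ℕ} {P : Pr (m + 1)}, Sg k P → ∀ i : Fin m,
    Sg k (fun M v => ∀ x : M, mle x (v i) → P M (sn v x))

section
variable {k : ℕ}

theorem Clo.pand (hk : Clo k) {m : ℕ} {P Q : Pr m} (hP : Pg k P) (hQ : Pg k Q) :
    Pg k (fun M v => P M v ∧ Q M v) :=
  Pg.of_neg ((hk.sor hP.neg hQ.neg).congr (fun M v => by tauto))

theorem Clo.por (hk : Clo k) {m : ℕ} {P Q : Pr m} (hP : Pg k P) (hQ : Pg k Q) :
    Pg k (fun M v => P M v ∨ Q M v) :=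
  Pg.of_neg ((hk.sand hP.neg hQ.neg).congr (fun M v => by tauto))

theorem Clo.pbex (hk : Clo k) {m : ℕ} {P : Pr (m + 1)} (hP : Pg k P) (i : Fin m) :
    Pg k (fun M v => ∃ x : M, mle x (v i) ∧ P M (sn v x)) :=
  Pg.of_neg ((hk.sball hP.neg i).congr (fun M v => by push Not; rfl))

theorem Clo.pball (hk : Clo k) {m : ℕ} {P : Pr (m + 1)} (hP : Pg k P) (i : Fin m) :
    Pg k (fun M v => ∀ x : M, mle x (v i) → P M (sn v x)) :=
  Pg.of_neg ((hk.sbex hP.neg i).congr (fun M v => by push Not; rfl))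

end

/-- `Q` is monotone in its last argument. -/
def Mon {m : ℕ} (Q : Pr (m + 1)) : Prop :=
  ∀ (M : PM) (v : Fin m → M) (a b : M), mle a b → Q M (sn v a) → Q M (sn v b)

def NF (k : ℕ) {m : ℕ} (P : Pr m) : Prop :=
  ∃ Q : Pr (m + 1), Pg k Q ∧ Mon Q ∧ ∀ (M : PM) (v : Fin m → M), P M v ↔ ∃ b : M, Q M (sn v b)

/-- The renaming exchanging the two last variables. -/
def swp (m : ℕ) : Fin (m + 2) → Fin (m + 2) :=
  sn (sn (fun i => i.castSucc.castSucc) (Fin.last (m + 1))) (Fin.last m).castSucc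

theorem sn_swp {A : Type} {m : ℕ} (v : Fin m → A) (x y : A) :
    sn (sn v x) y ∘ swp m = sn (sn v y) x := by
  unfold swp
  rw [comp_sn, comp_sn, sn_last, sn_castSucc, sn_last]
  congr 2
  funext i
  simp [sn_castSucc]

theorem sn_castSucc_comp {A : Type} {m : ℕ} (v : Fin m → A) (x : A) :
    sn v x ∘ Fin.castSucc = v := by
  funext i
  simp [sn_castSucc]

theorem nf_ex {k : ℕ} (hk : Clo k) {m : ℕ} {P : Pr (m + 1)} (h : NF k P) :
    NF k (fun M v => ∃ x : M, P M (sn v x)) := by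
  obtain ⟨Q, hQ, hm, e⟩ := h
  refine ⟨fun M w => ∃ x : M, mle x (w (Fin.last m)) ∧ Q M (sn w x ∘ swp m),
    hk.pbex (hQ.ren (swp m)) (Fin.last m), ?_, ?_⟩
  · rintro M v a b hab ⟨x, hx, hq⟩
    rw [sn_last] at hx
    rw [sn_swp] at hq
    refine ⟨x, ?_, ?_⟩
    · rw [sn_last]; exact mle_trans M hx hab
    · rw [sn_swp]; exact hm M _ _ _ hab hq
  · intro M v
    simp only [sn_last, sn_swp, e]
    constructor
    · rintro ⟨x, b, hq⟩
      obtain ⟨c, hx, hb⟩ := exists_ub M x b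
      exact ⟨c, x, hx, hm M _ _ _ hb hq⟩
    · rintro ⟨c, x, -, hq⟩
      exact ⟨x, c, hq⟩

theorem nf_fml {k : ℕ} (hk : Clo k) : ∀ {m : ℕ} {φ : LA.BoundedFormula Empty m},
    IsSigmaFml (k + 1) φ → NF k (fun (M : PM) (v : Fin m → M) => φ.Realize default v)
  | m, φ, .ofPi h => by
    have h' : Pg k (fun (M : PM) (v : Fin m → M) => φ.Realize default v) :=
      ⟨φ, h, fun _ _ => Iff.rfl⟩
    refine ⟨_, h'.ren Fin.castSucc, ?_, ?_⟩
    · intro M v a b _ hq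
      rw [sn_castSucc_comp] at hq ⊢
      exact hq
    · intro M v
      simp only [sn_castSucc_comp]
      exact ⟨fun h => ⟨zz M, h⟩, fun ⟨_, h⟩ => h⟩
  | _, _, .ex h => by
    obtain ⟨Q, h1, h2, h3⟩ := nf_ex hk (nf_fml hk h)
    refine ⟨Q, h1, h2, fun M v => ?_⟩
    exact (r_ex _ _ _).trans (h3 M v)

theorem Sg.nf {k : ℕ} (hk : Clo k) {m : ℕ} {P : Pr m} (h : Sg (k + 1) P) : NF k P := by
  obtain ⟨ψ, hψ, h⟩ := h
  obtain ⟨Q, h1, h2, h3⟩ := nf_fml hk hψ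
  exact ⟨Q, h1, h2, fun M v => (h M v).trans (h3 M v)⟩

theorem clo_zero : Clo 0 where
  sand h h' := Sg.ofD0 (h.toD0.and h'.toD0) 0
  sor h h' := Sg.ofD0 (h.toD0.or h'.toD0) 0
  sbex h i := Sg.ofD0 (h.toD0.bex i) 0
  sball h i := Sg.ofD0 (h.toD0.ball i) 0

/-- Collection. -/
theorem collection {m : ℕ} {Q : Pr (m + 2)} (hQ : Df Q) (hm : Mon Q) (M : PM) (v : Fin m → M)
    (y : M) (h : ∀ x : M, mle x y → ∃ b : M, Q M (sn (sn v x) b)) :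
    ∃ b : M, ∀ x : M, mle x y → Q M (sn (sn v x) b) := by
  -- variables: v, z, b, x
  have hR : Df (fun (M : PM) (w : Fin (m + 3) → M) =>
      mle (w (Fin.last (m + 2))) (w (Fin.last m).castSucc.castSucc) →
        Q M (w ∘ sn (sn (fun i => i.castSucc.castSucc.castSucc) (Fin.last (m + 2)))
          (Fin.last (m + 1)).castSucc)) :=
    (D0.le _ _).df.imp (hQ.ren _)
  have hA : Df (fun (M : PM) (w : Fin (m + 1) → M) => (∀ x : M, mle x (w (Fin.last m)) →
      ∃ b : M, Q M (sn (sn (w ∘ Fin.castSucc) x) b)) → ∃ b : M, ∀ x : M,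
      mle x (w (Fin.last m)) → Q M (sn (sn (w ∘ Fin.castSucc) x) b)) := by
    have hR2 : Df (fun (M : PM) (w : Fin (m + 2) → M) =>
        mle (w (Fin.last (m + 1))) (w (Fin.last m).castSucc) →
        ∃ b : M, Q M (sn w b ∘ sn (sn (fun i => i.castSucc.castSucc.castSucc)
          (Fin.last (m + 1)).castSucc) (Fin.last (m + 2)))) :=
      (D0.le _ _).df.imp (hQ.ren _).ex
    have := hR2.all.imp hR.all.ex
    obtain ⟨ψ, t, e⟩ := this
    refine ⟨ψ, t, fun M w => ?_⟩
    rw [← e]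
    have e1 : ∀ (x b : M), sn (sn w x) b ∘ (fun i : Fin m => i.castSucc.castSucc.castSucc) =
        w ∘ Fin.castSucc := by
      intro x b
      funext i
      simp [sn_castSucc]
    simp only [comp_sn, sn_last, sn_castSucc, e1]
  have key := hA.ind M v ?_ ?_ y
  · simp only [sn_last, sn_castSucc_comp] at key
    exact key h
  · simp only [sn_last, sn_castSucc_comp]
    intro h
    obtain ⟨b, hb⟩ := h (zz M) (mle_refl M _)
    refine ⟨b, fun x hx => ?_⟩
    rw [mle_zero M hx]
    exact hb
  · intro a
    simp only [sn_last, sn_castSucc_comp]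
    intro ih h
    obtain ⟨b, hb⟩ := ih (fun x hx => h x (mle_succ M hx))
    obtain ⟨c, hc⟩ := h (ss a) (mle_refl M _)
    obtain ⟨d, hbd, hcd⟩ := exists_ub M b c
    refine ⟨d, fun x hx => ?_⟩
    rcases mle_succ_cases M hx with hx | rfl
    · exact hm M _ _ _ hbd (hb x hx)
    · exact hm M _ _ _ hcd hc

theorem clo_succ {k : ℕ} (hk : Clo k) : Clo (k + 1) where
  sand h h' := by
    obtain ⟨Q, h1, h2, h3⟩ := h.nf hk
    obtain ⟨Q', h1', h2', h3'⟩ := h'.nf hk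
    refine (Sg.ex (Sg.ofPg (hk.pand h1 h1'))).congr (fun M v => ?_)
    rw [h3, h3']
    constructor
    · rintro ⟨⟨b, hb⟩, c, hc⟩
      obtain ⟨d, hd, hd'⟩ := exists_ub M b c
      exact ⟨d, h2 M _ _ _ hd hb, h2' M _ _ _ hd' hc⟩
    · rintro ⟨b, hb, hb'⟩
      exact ⟨⟨b, hb⟩, b, hb'⟩
  sor h h' := by
    obtain ⟨Q, h1, h2, h3⟩ := h.nf hk
    obtain ⟨Q', h1', h2', h3'⟩ := h'.nf hk
    refine (Sg.ex (Sg.ofPg (hk.por h1 h1'))).congr (fun M v => ?_)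
    rw [h3, h3', exists_or]
  sbex {m P} h i := by
    obtain ⟨Q, h1, h2, h3⟩ := h.nf hk
    refine (Sg.ex (Sg.ofPg (hk.pbex (h1.ren (swp m)) i.castSucc))).congr (fun M v => ?_)
    simp only [h3, sn_castSucc, sn_swp]
    constructor
    · rintro ⟨x, hx, b, hb⟩
      exact ⟨b, x, hx, hb⟩
    · rintro ⟨b, x, hx, hb⟩
      exact ⟨x, hx, b, hb⟩
  sball {m P} h i := by
    obtain ⟨Q, h1, h2, h3⟩ := h.nf hk
    refine (Sg.ex (Sg.ofPg (hk.pball (h1.ren (swp m)) i.castSucc))).congr (fun M v => ?_)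
    simp only [h3, sn_castSucc, sn_swp]
    constructor
    · exact collection h1.df h2 M v (v i)
    · rintro ⟨b, hb⟩ x hx
      exact ⟨b, hb x hx⟩

theorem clo : ∀ k, Clo k
  | 0 => clo_zero
  | k + 1 => clo_succ (clo k)

/-! ### The interpolation argument -/

theorem interp {k : ℕ} {φ σ : Snt} (hφ : φ ∈ PiS (k + 1)) (hσ : σ ∈ SigmaS (k + 1)) :
    ∃ δ ∈ SigmaS (k + 1), ∃ π ∈ PiS (k + 1), ∀ M : PM,
      (φ.Realize M → σ.Realize M → δ.Realize M) ∧ (δ.Realize M → σ.Realize M) ∧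
      ((φ.Realize M → σ.Realize M) → (δ.Realize M ↔ π.Realize M)) := by
  have hs : Sg (k + 1) (fun (M : PM) (v : Fin 0 → M) => BoundedFormula.Realize σ default v) :=
    ⟨σ, hσ, fun M v => Iff.rfl⟩
  have hf : Pg (k + 1) (fun (M : PM) (v : Fin 0 → M) => BoundedFormula.Realize φ default v) :=
    ⟨φ, hφ, fun _ _ => Iff.rfl⟩
  obtain ⟨s, s1, s2, s3⟩ := hs.nf (clo k)
  obtain ⟨q, q1, q2, q3⟩ := hf.neg.nf (clo k)
  have hp := q1.neg
  -- the Σ-form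
  have hb : Sg k (fun (M : PM) (w : Fin 1 → M) => ∀ c : M, mle c (w 0) →
      (sn w c 1 = sn w c 0 ∨ ¬ q M (sn w c ∘ (fun _ => 1)))) :=
    (clo k).sball ((clo k).sor (Sg.ofD0 (D0.eq 1 0) k) (hp.ren (fun _ => 1))) 0
  have hD1 := ((clo (k + 1)).sand (Sg.ofPg s1) hb.mono).ex
  have hD2 := ((clo (k + 1)).por (Pg.ofSg hp) s1.mono).all
  obtain ⟨δ, d1, d2⟩ := hD1
  obtain ⟨π, p1, p2⟩ := hD2
  refine ⟨δ, d1, π, p1, fun M => ?_⟩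
  have ew : ∀ b c : M, sn (sn (default : Fin 0 → M) b) c ∘ (fun _ : Fin 1 => (1 : Fin 2)) =
      sn default c := by
    intro b c
    funext i
    fin_cases i
    exact (sn2_1 _ _ _).trans (sn1_0 _ _).symm
  have eδ := d2 M default
  have eπ := p2 M default
  have eσ := s3 M default
  have eφ := q3 M default
  beta_reduce at eσ eφ
  simp only [sn1_0, sn2_0, sn2_1, ew] at eδ eπ
  have rδ : Sentence.Realize M δ ↔ BoundedFormula.Realize δ default (default : Fin 0 → M) := Iff.rfl
  have rπ : Sentence.Realize M π ↔ BoundedFormula.Realize π default (default : Fin 0 → M) := Iff.rfl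
  have rσ : σ.Realize M ↔ BoundedFormula.Realize σ default (default : Fin 0 → M) := Iff.rfl
  have rφ : φ.Realize M ↔ BoundedFormula.Realize φ default (default : Fin 0 → M) := Iff.rfl
  rw [rδ, rπ, rσ, rφ, ← eδ, ← eπ, eσ]
  have eφ' : BoundedFormula.Realize φ default (default : Fin 0 → M) ↔
      ∀ b : M, ¬ q M (sn default b) := by
    rw [← not_exists, ← eφ, not_not]
  rw [eφ']
  refine ⟨?_, ?_, ?_⟩
  · rintro hq ⟨b, hb⟩
    exact ⟨b, hb, fun c _ => Or.inr (hq c)⟩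
  · rintro ⟨b, hb, -⟩
    exact ⟨b, hb⟩
  · intro H
    constructor
    · rintro ⟨b, hb, hc⟩ x
      rcases mle_total M b x with h | h
      · exact Or.inr (s2 M _ _ _ h hb)
      · rcases hc x h with rfl | h'
        · exact Or.inr hb
        · exact Or.inl h'
    · intro h
      by_contra hn
      have hns : ∀ b : M, ¬ s M (sn default b) := by
        have hd : Df (fun (M : PM) (v : Fin 1 → M) => ¬ s M v) := s1.neg.df
        refine hd.ind M default ?_ ?_
        · intro h0
          exact hn ⟨_, h0, fun c hc => Or.inl (mle_zero M hc)⟩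
        · intro a ha h1
          refine hn ⟨_, h1, fun c hc => ?_⟩
          rcases mle_succ_cases M hc with hc | hc
          · rcases h c with h' | h'
            · exact Or.inr h'
            · exact (ha (s2 M _ _ _ hc h')).elim
          · exact Or.inl hc
      obtain ⟨b, hb⟩ := H (fun b => (h b).resolve_right (hns b))
      exact hns b hb

theorem prv_iff {T : Thy} {φ : Snt} : Prv T φ ↔ ∀ M : Theory.ModelType.{0, 0, 0} T, φ.Realize M :=
  Theory.models_sentence_iff

theorem prv_add {T : Thy} {φ ψ : Snt} :
    Prv (add T φ) ψ ↔ ∀ M : Theory.ModelType.{0, 0, 0} T, φ.Realize M → ψ.Realize M := by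
  rw [prv_iff]
  constructor
  · intro h M hM
    have : (M : Type) ⊨ add T φ := by
      refine (Theory.model_insert_iff).2 ⟨hM, inferInstance⟩
    exact h (Theory.ModelType.of (add T φ) M)
  · intro h M
    obtain ⟨h1, h2⟩ := (Theory.model_insert_iff (T := T) (φ := φ) (M := M)).1
      (inferInstanceAs ((M : Type) ⊨ add T φ))
    exact h (Theory.ModelType.of T M) h1

theorem toPM {T : Thy} (hT : ExtPA T) (M : Theory.ModelType.{0, 0, 0} T) : (M : Type) ⊨ PAAx :=
  ⟨fun φ hφ => prv_iff.1 (hT φ hφ) M⟩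

theorem prv_Th {T : Thy} {φ : Snt} (h : Prv T φ) : Prv (Th T) φ :=
  prv_iff.2 fun _ => Theory.realize_sentence_of_mem (Th T) h

/-- Propositions 5.3 and 6.1. -/
theorem stmt_11 (T : Thy) (hT : GoodThy T) (n : ℕ) (hn : 1 ≤ n) :
    (∀ φ ∈ SigmaS n, SPCons n T φ → ConsIn (PiS n) T φ) ∧
    (∀ φ ∈ PiS n, SPCons n T φ → ConsIn (SigmaS n) T φ) ∧
    (∀ φ ∈ PiS n, DeltaCons n T φ → ConsIn (SigmaS n) T φ) := by
  refine ⟨?_, ?_, ?_⟩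
  · intro φ hφ h π hπ hp
    rw [prv_add] at hp
    have h1 := h φ hφ π hπ (prv_add.2 fun M hM => Formula.realize_inf.2 ⟨hM, hp M hM⟩)
    rw [prv_iff] at h1 ⊢
    intro M
    rcases Formula.realize_sup.1 (h1 M) with h2 | h2
    · exact hp M h2
    · exact h2
  · intro φ hφ h σ hσ hp
    rw [prv_add] at hp
    have h1 := h σ hσ φ hφ (prv_add.2 fun M hM => Formula.realize_inf.2 ⟨hp M hM, hM⟩)
    rw [prv_iff] at h1 ⊢
    intro M
    rcases Formula.realize_sup.1 (h1 M) with h2 | h2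
    · exact h2
    · exact hp M h2
  · intro φ hφ h σ hσ hp
    obtain ⟨k, rfl⟩ : ∃ k, n = k + 1 := ⟨n - 1, by omega⟩
    obtain ⟨δ, hδ, π, hπ, H⟩ := interp hφ hσ
    rw [prv_add] at hp
    have H' : ∀ M : Theory.ModelType.{0, 0, 0} T,
      (φ.Realize M → σ.Realize M → δ.Realize M) ∧ (δ.Realize M → σ.Realize M) ∧
      ((φ.Realize M → σ.Realize M) → (δ.Realize M ↔ π.Realize M)) := fun M =>
      haveI := toPM hT.2.2 M
      H (Theory.ModelType.of PAAx M)
    have h1 : Prv T δ := by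
      refine h δ ⟨⟨δ, hδ, ?_⟩, π, hπ, ?_⟩ ?_
      · exact prv_iff.2 fun M => Formula.realize_iff.2 Iff.rfl
      · exact prv_Th (prv_iff.2 fun M => Formula.realize_iff.2 ((H' M).2.2 (hp M)))
      · exact prv_add.2 fun M hM => (H' M).1 hM (hp M hM)
    rw [prv_iff] at h1 ⊢
    exact fun M => (H' M).2.1 (h1 M)

end Guaspari
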